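/- Fix an integer m ≥ 2, a real number c ≠ 0, real constants A, B, C, and an open interval I of the variable φ containing neither 0 nor c. Define Q(φ) = (ψ−1)(A + B·E(ψ) + C·F(ψ)) with ψ = φ/c, and set σ = Q/(2(φ−c)) on I. Then the function φ ↦ mσ − (φ−c)²σ'' − m(φ−c)σ' + 2(m−1)(φ−c)²σ'/φ is constant on I, and its value is mA/(2c). -/

import Mathlib

open Set

/-- The rational function `F(t) = (t−2)·t^{2m−1}/(t−1)^m` of §21. -/
noncomputable def Ffun (m : ℕ) : ℝ → ℝ := fun t =>
  (t - 2) * t ^ (2 * m - 1) / (t - 1) ^ m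

/-- The polynomial `E(t) = (t−1)·∑_{k=1}^m (k/m)·binom(2m−k−1, m−1)·t^{k−1}` of §21. -/
noncomputable def Efun (m : ℕ) : ℝ → ℝ := fun t =>
  (t - 1) * ∑ k ∈ Finset.Icc 1 m,
    ((k : ℝ) / (m : ℝ)) * ((2 * m - k - 1).choose (m - 1) : ℝ) * t ^ (k - 1)

/-- `u` solves, off `0` and `1`, the equation
`m u - (t-1)² u'' - m (t-1) u' + 2 (m-1) (t-1)² u' / t = 0`. -/
def SolvesEquation (m : ℝ) (u : ℝ → ℝ) : Prop :=
  ∃ u' u'' : ℝ → ℝ, ∀ t : ℝ, t ≠ 0 → t ≠ 1 →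
    HasDerivAt u (u' t) t ∧ HasDerivAt u' (u'' t) t ∧
      m * u t - (t - 1) ^ 2 * u'' t - m * (t - 1) * u' t +
        2 * (m - 1) * (t - 1) ^ 2 * u' t / t = 0

lemma hasDerivAt_mul_pow_div_pow (a b : ℕ) {r : ℝ → ℝ} {r' t : ℝ} (hr : HasDerivAt r r' t)
    (ht : t ≠ 1) :
    HasDerivAt (fun t => r t * t ^ (a + 1) / (t - 1) ^ b)
      ((r' * t * (t - 1) + (a + 1) * r t * (t - 1) - b * t * r t) * t ^ a / (t - 1) ^ (b + 1))
      t := by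
  have h1 : t - 1 ≠ 0 := sub_ne_zero.mpr ht
  have hb := ((hasDerivAt_id t).sub_const 1).pow b
  have ha := hasDerivAt_pow (a + 1) t
  refine ((hr.mul ha).div hb (pow_ne_zero b h1)).congr_deriv ?_
  cases b with
  | zero => simp; field_simp; ring
  | succ b => simp; field_simp; ring

lemma Ffun_solvesEquation {m : ℕ} (hm : 2 ≤ m) : SolvesEquation m (Ffun m) := by
  obtain ⟨n, rfl⟩ := Nat.exists_eq_add_of_le' hm
  let R : ℝ → ℝ := fun t => t * (t - 1) + (2 * n + 3) * (t - 2) * (t - 1) - (n + 2) * t * (t - 2)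
  let R' : ℝ → ℝ := fun t => (2 * t - 1) + (2 * n + 3) * (2 * t - 3) - (n + 2) * (2 * t - 2)
  refine ⟨fun t => R t * t ^ (2 * n + 1 + 1) / (t - 1) ^ (n + 3),
    fun t => (R' t * t * (t - 1) + ((2 * n + 1 : ℕ) + 1) * R t * (t - 1) - (n + 3 : ℕ) * t * R t)
      * t ^ (2 * n + 1) / (t - 1) ^ (n + 3 + 1), fun t h0 h1 => ⟨?_, ?_, ?_⟩⟩
  · have h := hasDerivAt_mul_pow_div_pow (2 * n + 2) (n + 2) ((hasDerivAt_id t).sub_const 2) h1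
    refine (h.congr_deriv ?_)
    simp only [R, id]
    push_cast
    ring
  · refine hasDerivAt_mul_pow_div_pow (2 * n + 1) (n + 3) ?_ h1
    have hi := hasDerivAt_id t
    refine (((hi.mul (hi.sub_const 1)).add (((hi.sub_const 2).const_mul (2 * n + 3 : ℝ)).mul
      (hi.sub_const 1))).sub ((hi.const_mul (n + 2 : ℝ)).mul (hi.sub_const 2))).congr_deriv ?_
    simp only [R', id]
    ring
  · have h1' : t - 1 ≠ 0 := sub_ne_zero.mpr h1
    have e : 2 * (n + 2) - 1 = 2 * n + 3 := by omega
    simp only [Ffun, R, R', e]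
    push_cast
    field_simp
    ring

open Polynomial in
/-- The cofactor of `t - 1` in `Efun m`. -/
noncomputable def cofactorPoly (m : ℕ) : ℝ[X] :=
  ∑ j ∈ Finset.range m, monomial j (((j : ℝ) + 1) / m * ((2 * m - 2 - j).choose (m - 1) : ℝ))

lemma cofactorPoly_coeff {m : ℕ} (hm : 2 ≤ m) (j : ℕ) :
    (cofactorPoly m).coeff j = ((j : ℝ) + 1) / m * ((2 * m - 2 - j).choose (m - 1) : ℝ) := by
  simp only [cofactorPoly, Polynomial.finsetSum_coeff, Polynomial.coeff_monomial,
    Finset.sum_ite_eq', Finset.mem_range]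
  split_ifs with h
  · rfl
  · rw [Nat.choose_eq_zero_of_lt (by omega)]
    simp

lemma Efun_eq (m : ℕ) (t : ℝ) : Efun m t = (t - 1) * (cofactorPoly m).eval t := by
  rw [Efun, cofactorPoly, Polynomial.eval_finsetSum, Finset.range_eq_Ico,
    ← Finset.Ico_add_one_right_eq_Icc, Finset.sum_Ico_eq_sum_range, ← Finset.range_eq_Ico]
  congr 1
  refine Finset.sum_congr (by simp) fun j _ => ?_
  rw [Polynomial.eval_monomial, show 2 * m - (1 + j) - 1 = 2 * m - 2 - j by omega,
    Nat.add_sub_cancel_left]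
  push_cast
  ring

lemma cofactorPoly_coeff_succ {m : ℕ} (hm : 2 ≤ m) (j : ℕ) :
    (cofactorPoly m).coeff (j + 1) * (j + 1) * (2 * m - 2 - j) =
      (cofactorPoly m).coeff j * (m - 1 - j) * (j + 2) := by
  rw [cofactorPoly_coeff hm, cofactorPoly_coeff hm]
  rcases lt_or_ge j m with h | h
  · obtain ⟨k, rfl⟩ := Nat.exists_eq_add_of_le' hm
    obtain ⟨i, hi⟩ := Nat.exists_eq_add_of_le (Nat.lt_succ_iff.mp h)
    have h1 : 2 * (k + 2) - 2 - j = k + i + 1 := by omega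
    have h2 : 2 * (k + 2) - 2 - (j + 1) = k + i := by omega
    have h3 := Nat.choose_mul_succ_eq (k + i) (k + 1)
    rw [show k + i + 1 - (k + 1) = i by omega] at h3
    have hk : (k : ℝ) = j + i - 1 := by
      have : (k : ℝ) + 1 = j + i := by exact_mod_cast hi
      linarith
    have h3' : (((k + i).choose (k + 1) : ℕ) : ℝ) * (k + i + 1) =
      ((k + i + 1).choose (k + 1) : ℕ) * i := by exact_mod_cast h3
    rw [h1, h2, show k + 2 - 1 = k + 1 by omega]
    push_cast
    have e1 : 2 * ((k : ℝ) + 2) - 2 - j = k + i + 1 := by linarith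
    have e2 : (k : ℝ) + 2 - 1 - j = i := by linarith
    rw [e1, e2]
    linear_combination ((j : ℝ) + 2) * (j + 1) / (k + 2) * h3'
  · rw [Nat.choose_eq_zero_of_lt (by omega), Nat.choose_eq_zero_of_lt (by omega)]
    simp

open Polynomial in
lemma cofactorPoly_equation {m : ℕ} (hm : 2 ≤ m) :
    X * derivative (derivative (cofactorPoly m))
      - X * (X * derivative (derivative (cofactorPoly m)))
      + C ((m : ℝ) - 4) * (X * derivative (cofactorPoly m))
      - C (2 * ((m : ℝ) - 1)) * derivative (cofactorPoly m)
      + C (2 * ((m : ℝ) - 1)) * cofactorPoly m = 0 := by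
  ext j
  have h := cofactorPoly_coeff_succ hm j
  rcases j with _ | _ | j <;>
  · simp only [coeff_add, coeff_sub, coeff_C_mul, coeff_X_mul,
      coeff_derivative, coeff_zero, mul_coeff_zero, coeff_X_zero, zero_add, coeff_C_zero] at h ⊢
    push_cast at h ⊢
    linear_combination -h

lemma Efun_solvesEquation {m : ℕ} (hm : 2 ≤ m) : SolvesEquation m (Efun m) := by
  set P := cofactorPoly m with hP
  refine ⟨fun t => P.eval t + (t - 1) * P.derivative.eval t,
    fun t => 2 * P.derivative.eval t + (t - 1) * P.derivative.derivative.eval t,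
    fun t h0 _ => ⟨?_, ?_, ?_⟩⟩
  · rw [funext (Efun_eq m)]
    refine (((hasDerivAt_id t).sub_const 1).mul (P.hasDerivAt t)).congr_deriv ?_
    simp
  · refine ((P.hasDerivAt t).add
      (((hasDerivAt_id t).sub_const 1).mul (P.derivative.hasDerivAt t))).congr_deriv ?_
    simp only [id]
    ring
  · have h := congrArg (Polynomial.eval t) (cofactorPoly_equation hm)
    simp only [Polynomial.eval_add, Polynomial.eval_sub, Polynomial.eval_mul, Polynomial.eval_C,
      Polynomial.eval_X, Polynomial.eval_zero, ← hP] at h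
    rw [Efun_eq, ← hP]
    field_simp
    linear_combination (t - 1) ^ 2 * h

/-- final part of Remark 21.3. -/
theorem stmt_13 (m : ℕ) (hm : 2 ≤ m) (c : ℝ) (hc : c ≠ 0) (A B C : ℝ)
    (p q : ℝ) (hpq : p < q) (h0 : (0 : ℝ) ∉ Ioo p q) (hcI : c ∉ Ioo p q)
    (Q σ : ℝ → ℝ)
    (hQdef : ∀ x : ℝ, Q x = (x / c - 1) * (A + B * Efun m (x / c) + C * Ffun m (x / c)))
    (hσdef : ∀ x : ℝ, σ x = Q x / (2 * (x - c))) :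
    ∀ x ∈ Ioo p q,
      (m : ℝ) * σ x - (x - c) ^ 2 * deriv (deriv σ) x -
        (m : ℝ) * (x - c) * deriv σ x +
        2 * ((m : ℝ) - 1) * (x - c) ^ 2 * deriv σ x / x = (m : ℝ) * A / (2 * c) := by
  intro x hx
  obtain ⟨E', E'', hE⟩ := Efun_solvesEquation hm
  obtain ⟨F', F'', hF⟩ := Ffun_solvesEquation hm
  have hne : ∀ y ∈ Ioo p q, y ≠ 0 ∧ y - c ≠ 0 ∧ y / c ≠ 0 ∧ y / c ≠ 1 := fun y hy => by
    have hy0 : y ≠ 0 := fun h => h0 (h ▸ hy)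
    have hyc : y ≠ c := fun h => hcI (h ▸ hy)
    exact ⟨hy0, sub_ne_zero.mpr hyc, div_ne_zero hy0 hc, fun h => hyc ((div_eq_one_iff_eq hc).mp h)⟩
  have hσ : ∀ y ∈ Ioo p q,
      σ y = (A + B * Efun m (y / c) + C * Ffun m (y / c)) / (2 * c) := fun y hy => by
    have := (hne y hy).2.1
    rw [hσdef, hQdef]
    field_simp
  have hσ' : ∀ y ∈ Ioo p q,
      deriv σ y = (B * E' (y / c) + C * F' (y / c)) / (2 * c ^ 2) := fun y hy => by
    obtain ⟨-, -, h2, h3⟩ := hne y hy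
    have hd := (hasDerivAt_id y).div_const c
    have hEd := (hE _ h2 h3).1.comp y hd
    have hFd := (hF _ h2 h3).1.comp y hd
    have hg := (((hEd.const_mul B).const_add A).add (hFd.const_mul C)).div_const (2 * c)
    rw [(hg.congr_of_eventuallyEq
      (Filter.eventuallyEq_of_mem (isOpen_Ioo.mem_nhds hy) hσ)).deriv]
    field_simp
  obtain ⟨hx0, hxc, h2, h3⟩ := hne x hx
  have hσ'' : deriv (deriv σ) x = (B * E'' (x / c) + C * F'' (x / c)) / (2 * c ^ 3) := by
    have hd := (hasDerivAt_id x).div_const c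
    have hEd := (hE _ h2 h3).2.1.comp x hd
    have hFd := (hF _ h2 h3).2.1.comp x hd
    have hg := ((hEd.const_mul B).add (hFd.const_mul C)).div_const (2 * c ^ 2)
    rw [(hg.congr_of_eventuallyEq
      (Filter.eventuallyEq_of_mem (isOpen_Ioo.mem_nhds hx) hσ')).deriv]
    field_simp
  have eE := (hE _ h2 h3).2.2
  have eF := (hF _ h2 h3).2.2
  rw [hσ x hx, hσ' x hx, hσ'']
  obtain ⟨t, rfl⟩ : ∃ t, x = t * c := ⟨x / c, by field_simp⟩
  rw [mul_div_cancel_right₀ t hc] at *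
  field_simp at eE eF ⊢
  linear_combination B * eE + C * eF
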